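/- Let r be a positive integer, σ > 0, and let θ₀ > 0 be the true parameter. Let Z be standard normal and U be χ²_r (Gamma with shape r/2, rate 1/2), independent, and set X = θ₀ + σZ and W = σ²U. Let F be the cumulative distribution function of Z/√U. Define the plausibility of the assertion {θ = θ₀} by pl(X,W) = 2F((X−θ₀)/√W) if F((X−θ₀)/√W) < 1/2, and pl(X,W) = 2(1 − F((X−θ₀)/√W)) otherwise; equivalently pl(X,W) = 1 − |2F((X−θ₀)/√W) − 1|. Then for every α ∈ (0,1), P{pl(X,W) ≤ α} = α. -/

import Mathlib

open MeasureTheory ProbabilityTheory Real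

/-- The joint law of `(Z, U)` with `Z ~ N(0,1)` and `U ~ χ²_r` independent. -/
noncomputable def jointZU (r : ℕ) : Measure (ℝ × ℝ) :=
  (gaussianReal 0 1).prod (gammaMeasure ((r : ℝ) / 2) (1 / 2))

/-- The CDF `F` of the pivot `Z/√U`. -/
noncomputable def pivotCDF (r : ℕ) : ℝ → ℝ :=
  cdf (Measure.map (fun p : ℝ × ℝ => p.1 / Real.sqrt p.2) (jointZU r))

lemma gamma_ae_pos {a b : ℝ} : ∀ᵐ u ∂(gammaMeasure a b), 0 < u := by
  have h : gammaMeasure a b (Set.Iic 0) = 0 := by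
    rw [gammaMeasure, withDensity_apply _ measurableSet_Iic,
      setLIntegral_congr (Iio_ae_eq_Iic (a := (0 : ℝ))).symm]
    exact lintegral_gammaPDF_of_nonpos le_rfl
  rw [ae_iff]
  convert h using 2
  ext u
  simp

lemma meas_T : Measurable (fun p : ℝ × ℝ => p.1 / Real.sqrt p.2) := by fun_prop

lemma prob_joint (r : ℕ) (hr : 0 < r) : IsProbabilityMeasure (jointZU r) := by
  have hr' : (0 : ℝ) < (r : ℝ) / 2 := by positivity
  have := isProbabilityMeasure_gammaMeasure hr' (by norm_num : (0 : ℝ) < 1 / 2)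
  unfold jointZU
  infer_instance

lemma pivot_singleton (r : ℕ) (hr : 0 < r) (c : ℝ) :
    Measure.map (fun p : ℝ × ℝ => p.1 / Real.sqrt p.2) (jointZU r) {c} = 0 := by
  have hr' : (0 : ℝ) < (r : ℝ) / 2 := by positivity
  have := isProbabilityMeasure_gammaMeasure hr' (by norm_num : (0 : ℝ) < 1 / 2)
  have : NullSingletonClass (gaussianReal 0 1) := nullSingletonClass_gaussianReal one_ne_zero
  rw [Measure.map_apply meas_T (measurableSet_singleton c), jointZU,
    Measure.prod_apply_symm (meas_T (measurableSet_singleton c)), lintegral_eq_zero_iff']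
  · filter_upwards [gamma_ae_pos] with u hu
    refine measure_mono_null (t := {c * √u}) ?_ (measure_singleton _)
    intro z hz
    have hs : 0 < √u := Real.sqrt_pos.2 hu
    simp only [Set.mem_preimage, Set.mem_singleton_iff] at hz ⊢
    rw [← hz]
    field_simp
  · exact (measurable_measure_prodMk_right (meas_T (measurableSet_singleton c))).aemeasurable

lemma cdf_continuous (ν : Measure ℝ) [IsProbabilityMeasure ν] (h : ∀ c, ν {c} = 0) :
    Continuous (cdf ν) := by
  rw [continuous_iff_continuousAt]
  intro x
  rw [(monotone_cdf ν).continuousAt_iff_leftLim_eq_rightLim, (cdf ν).rightLim_eq]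
  have h1 := h x
  rw [← measure_cdf ν, StieltjesFunction.measure_singleton, ENNReal.ofReal_eq_zero] at h1
  exact le_antisymm ((monotone_cdf ν).leftLim_le le_rfl) (by linarith)

lemma exists_cdf (ν : Measure ℝ) [IsProbabilityMeasure ν] (h : ∀ c, ν {c} = 0)
    {a : ℝ} (ha : 0 < a) (ha1 : a < 1) : ∃ x, cdf ν x = a := by
  obtain ⟨y, hy⟩ := ((tendsto_cdf_atBot ν).eventually (eventually_le_nhds ha)).exists
  obtain ⟨z, hz⟩ := ((tendsto_cdf_atTop ν).eventually (eventually_ge_nhds ha1)).exists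
  exact mem_range_of_exists_le_of_exists_ge (cdf_continuous ν h) ⟨y, hy⟩ ⟨z, hz⟩

lemma real_lt_le (ν : Measure ℝ) [IsProbabilityMeasure ν] (h : ∀ c, ν {c} = 0)
    {a : ℝ} (ha : 0 < a) (ha1 : a < 1) : ν.real {x | cdf ν x < a} ≤ a := by
  obtain ⟨x, hx⟩ := exists_cdf ν h ha ha1
  conv_rhs => rw [← hx, cdf_eq_real]
  refine measureReal_mono ?_
  intro y hy
  by_contra hxy
  have := monotone_cdf ν (not_le.1 hxy).le
  simp only [Set.mem_ofPred_eq] at hy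
  linarith

lemma real_le_ge (ν : Measure ℝ) [IsProbabilityMeasure ν] (h : ∀ c, ν {c} = 0)
    {a : ℝ} (ha : 0 < a) (ha1 : a < 1) : a ≤ ν.real {x | cdf ν x ≤ a} := by
  obtain ⟨x, hx⟩ := exists_cdf ν h ha ha1
  conv_lhs => rw [← hx, cdf_eq_real]
  refine measureReal_mono ?_
  intro y hy
  have := monotone_cdf ν (Set.mem_Iic.1 hy)
  simp only [Set.mem_ofPred_eq]
  linarith

lemma real_le_eq (ν : Measure ℝ) [IsProbabilityMeasure ν] (h : ∀ c, ν {c} = 0)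
    {a : ℝ} (ha : 0 < a) (ha1 : a < 1) : ν.real {x | cdf ν x ≤ a} = a := by
  refine le_antisymm ?_ (real_le_ge ν h ha ha1)
  refine le_of_forall_gt_imp_ge_of_dense fun b hb => ?_
  by_cases hb1 : b < 1
  · refine le_trans (measureReal_mono ?_) (real_lt_le ν h (ha.trans hb) hb1)
    intro y hy
    exact lt_of_le_of_lt hy hb
  · exact measureReal_le_one.trans (not_lt.1 hb1)

lemma real_lt_eq (ν : Measure ℝ) [IsProbabilityMeasure ν] (h : ∀ c, ν {c} = 0)
    {a : ℝ} (ha : 0 < a) (ha1 : a < 1) : ν.real {x | cdf ν x < a} = a := by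
  refine le_antisymm (real_lt_le ν h ha ha1) ?_
  refine le_of_forall_lt_imp_le_of_dense fun b hb => ?_
  by_cases hb0 : 0 < b
  · refine le_trans (real_le_ge ν h hb0 (hb.trans ha1)) (measureReal_mono ?_)
    intro y hy
    exact lt_of_le_of_lt hy hb
  · exact (not_lt.1 hb0).trans measureReal_nonneg

/-- **Validity in the interior (θ₀ > 0), Theorem 2 of the paper.**
In the constrained normal model with true parameter `θ₀ > 0`, set `X = θ₀ + σZ`,
`W = σ²U`, and define the plausibility of `{θ = θ₀}` by `pl = 2F((X−θ₀)/√W)` if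
`F((X−θ₀)/√W) < 1/2` and `pl = 2(1 − F((X−θ₀)/√W))` otherwise (equivalently,
`pl = 1 − |2F((X−θ₀)/√W) − 1|`). Then `P{pl ≤ α} = α` for every `α ∈ (0,1)`. -/
theorem im_plausibility_interior_exact (r : ℕ) (hr : 0 < r)
    (σ : ℝ) (hσ : 0 < σ) (θ₀ : ℝ) (hθ₀ : 0 < θ₀)
    (α : ℝ) (hα : α ∈ Set.Ioo (0 : ℝ) 1)
    (pl : ℝ × ℝ → ℝ)
    (hpl : ∀ p : ℝ × ℝ,
      pl p = if pivotCDF r ((θ₀ + σ * p.1 - θ₀) / Real.sqrt (σ ^ 2 * p.2)) < 1 / 2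
        then 2 * pivotCDF r ((θ₀ + σ * p.1 - θ₀) / Real.sqrt (σ ^ 2 * p.2))
        else 2 * (1 - pivotCDF r ((θ₀ + σ * p.1 - θ₀) / Real.sqrt (σ ^ 2 * p.2)))) :
    jointZU r {p | pl p ≤ α} = ENNReal.ofReal α := by
  obtain ⟨hα0, hα1⟩ := hα
  have := prob_joint r hr
  set ν := Measure.map (fun p : ℝ × ℝ => p.1 / Real.sqrt p.2) (jointZU r) with hν
  have : IsProbabilityMeasure ν := Measure.isProbabilityMeasure_map meas_T.aemeasurable
  have hat : ∀ c, ν {c} = 0 := pivot_singleton r hr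
  have hF : pivotCDF r = cdf ν := rfl
  have hm : Measurable (cdf ν) := (cdf_continuous ν hat).measurable
  have hm1 : MeasurableSet {x | cdf ν x ≤ α / 2} := measurableSet_le hm measurable_const
  have hm2 : MeasurableSet {x | cdf ν x < 1 - α / 2} := measurableSet_lt hm measurable_const
  have hset : {p | pl p ≤ α} = (fun p : ℝ × ℝ => p.1 / Real.sqrt p.2) ⁻¹'
      ({x | cdf ν x ≤ α / 2} ∪ {x | cdf ν x < 1 - α / 2}ᶜ) := by
    ext p
    have e : (θ₀ + σ * p.1 - θ₀) / Real.sqrt (σ ^ 2 * p.2) = p.1 / Real.sqrt p.2 := by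
      rw [Real.sqrt_mul (by positivity), Real.sqrt_sq hσ.le, add_sub_cancel_left,
        mul_div_mul_left _ _ hσ.ne']
    simp only [Set.mem_ofPred_eq, Set.mem_preimage, Set.mem_union, Set.mem_compl_iff, not_lt]
    rw [hpl p, e, hF]
    split_ifs with h
    · constructor
      · intro h'; left; linarith
      · rintro (h' | h') <;> linarith
    · constructor
      · intro h'; right; linarith
      · rintro (h' | h') <;> linarith
  rw [hset, ← Measure.map_apply meas_T (hm1.union hm2.compl), ← hν, ← ofReal_measureReal]
  congr 1
  rw [measureReal_union _ hm2.compl, probReal_compl_eq_one_sub hm2,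
    real_le_eq ν hat (by linarith) (by linarith), real_lt_eq ν hat (by linarith) (by linarith)]
  · ring
  · rw [Set.disjoint_compl_right_iff_subset]
    intro x hx
    simp only [Set.mem_ofPred_eq] at hx ⊢
    linarith
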